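/- arXiv:1102.2597 — 2 statements merged into one kernel-verified Lean document; each statement's English description precedes it below -/
import Mathlib

section
/- Fix α ∈ (0,1] and T = 1/(2α). Define ρ̄ : (−1,1) × (0,T) → ℝ by ρ̄(x₂,t) = −1 for x₂ < −2αt, ρ̄(x₂,t) = x₂/(2αt) for |x₂| ≤ 2αt, ρ̄(x₂,t) = 1 for x₂ > 2αt, and set m̄₂ = −α(1 − ρ̄²). Then |ρ̄| ≤ 1 and −(1 − ρ̄²) ≤ m̄₂ ≤ 0 everywhere, and the pair (ρ̄, m̄₂) solves ∂_t ρ̄ + ∂_{x₂} m̄₂ = 0 weakly with initial data sign(x₂) and zero flux at x₂ = ±1; that is, for every φ ∈ C^∞([−1,1] × [0,T)) with compact support in time, ∫₀^T ∫_{−1}^{1} (∂_t φ · ρ̄ + ∂_{x₂} φ · m̄₂) dx₂ dt + ∫_{−1}^{1} φ(x₂,0) sign(x₂) dx₂ = 0. -/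
open MeasureTheory

/-- Partial derivative in x₂ of a function of (x₂, t). -/
noncomputable def dx (φ : ℝ × ℝ → ℝ) (p : ℝ × ℝ) : ℝ := deriv (fun s => φ (s, p.2)) p.1

/-- Partial derivative in t of a function of (x₂, t). -/
noncomputable def dt (φ : ℝ × ℝ → ℝ) (p : ℝ × ℝ) : ℝ := deriv (fun s => φ (p.1, s)) p.2

/-- The entropy solution of Burgers' equation giving the coarse-grained density. -/
noncomputable def rhobar (α : ℝ) (p : ℝ × ℝ) : ℝ :=
  if p.1 < -(2 * α * p.2) then -1
  else if 2 * α * p.2 < p.1 then 1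
  else p.1 / (2 * α * p.2)

/-- The vertical momentum component m̄₂ = −α(1 − ρ̄²). -/
noncomputable def mbar2 (α : ℝ) (p : ℝ × ℝ) : ℝ := -α * (1 - rhobar α p ^ 2)

/-- The derivative of `-rhobar` in time, which is also the derivative of `mbar2` in space, away
from the boundary of the fan `|x| = 2αt`. -/
noncomputable def fanSlope (α : ℝ) (p : ℝ × ℝ) : ℝ :=
  if |p.1| < 2 * α * p.2 then p.1 / (2 * α * p.2 ^ 2) else 0

theorem dt_hasDerivAt {φ : ℝ × ℝ → ℝ} (hφ : ContDiff ℝ (⊤ : ℕ∞) φ) (x t : ℝ) :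
    HasDerivAt (fun s => φ (x, s)) (dt φ (x, t)) t := by
  have h : Differentiable ℝ φ := hφ.differentiable (by simp)
  have h2 : Differentiable ℝ (fun s : ℝ => φ (x, s)) := by fun_prop
  exact (h2 t).hasDerivAt

theorem dx_hasDerivAt {φ : ℝ × ℝ → ℝ} (hφ : ContDiff ℝ (⊤ : ℕ∞) φ) (x t : ℝ) :
    HasDerivAt (fun s => φ (s, t)) (dx φ (x, t)) x := by
  have h : Differentiable ℝ φ := hφ.differentiable (by simp)
  have h2 : Differentiable ℝ (fun s : ℝ => φ (s, t)) := by fun_prop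
  exact (h2 x).hasDerivAt

theorem continuous_dt {φ : ℝ × ℝ → ℝ} (hφ : ContDiff ℝ (⊤ : ℕ∞) φ) : Continuous (dt φ) := by
  have h : Differentiable ℝ φ := hφ.differentiable (by simp)
  have heq : dt φ = fun p => fderiv ℝ φ p (0, 1) := by
    funext p
    exact ((h p).hasFDerivAt.comp_hasDerivAt p.2
      ((hasDerivAt_const p.2 p.1).prodMk (hasDerivAt_id p.2))).deriv
  rw [heq]
  exact (hφ.continuous_fderiv (by simp)).clm_apply continuous_const

theorem continuous_dx {φ : ℝ × ℝ → ℝ} (hφ : ContDiff ℝ (⊤ : ℕ∞) φ) : Continuous (dx φ) := by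
  have h : Differentiable ℝ φ := hφ.differentiable (by simp)
  have heq : dx φ = fun p => fderiv ℝ φ p (1, 0) := by
    funext p
    exact ((h p).hasFDerivAt.comp_hasDerivAt p.1
      ((hasDerivAt_id p.1).prodMk (hasDerivAt_const p.1 p.2))).deriv
  rw [heq]
  exact (hφ.continuous_fderiv (by simp)).clm_apply continuous_const

theorem measurable_rhobar (α : ℝ) : Measurable (rhobar α) := by
  unfold rhobar
  refine Measurable.ite (measurableSet_lt (by fun_prop) (by fun_prop)) (by fun_prop) ?_
  exact Measurable.ite (measurableSet_lt (by fun_prop) (by fun_prop)) (by fun_prop) (by fun_prop)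

theorem measurable_mbar2 (α : ℝ) : Measurable (mbar2 α) :=
  (((measurable_rhobar α).pow_const 2).const_sub 1).const_mul (-α)

theorem measurable_fanSlope (α : ℝ) : Measurable (fanSlope α) := by
  unfold fanSlope
  exact Measurable.ite (measurableSet_lt (by fun_prop) (by fun_prop)) (by fun_prop) (by fun_prop)

theorem rhobar_eq_div_max {α : ℝ} (hα : 0 < α) (x : ℝ) {t : ℝ} (ht : 0 ≤ t) :
    rhobar α (x, t) = x / max |x| (2 * α * t) := by
  have hc : 0 ≤ 2 * α * t := by positivity
  unfold rhobar
  dsimp only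
  split_ifs with h1 h2
  · have hx : x < 0 := by linarith
    rw [abs_of_neg hx, max_eq_left (by linarith), div_neg, div_self hx.ne]
  · have hx : 0 < x := by linarith
    rw [abs_of_pos hx, max_eq_left h2.le, div_self hx.ne']
  · rw [max_eq_right (abs_le.2 ⟨by linarith, by linarith⟩)]

theorem abs_rhobar_le_one {α : ℝ} (hα : 0 < α) (x : ℝ) {t : ℝ} (ht : 0 ≤ t) :
    |rhobar α (x, t)| ≤ 1 := by
  rw [rhobar_eq_div_max hα x ht, abs_div]
  refine div_le_one_of_le₀ ?_ (abs_nonneg _)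
  exact (le_max_left _ _).trans (le_abs_self _)

theorem abs_mbar2_le {α : ℝ} (hα : 0 < α) (x : ℝ) {t : ℝ} (ht : 0 ≤ t) :
    |mbar2 α (x, t)| ≤ α := by
  have h := (sq_le_one_iff_abs_le_one _).2 (abs_rhobar_le_one hα x ht)
  have h0 := sq_nonneg (rhobar α (x, t))
  unfold mbar2
  rw [abs_le]
  constructor <;> nlinarith

theorem rhobar_zero {α x : ℝ} (hx : x ≠ 0) : rhobar α (x, 0) = Real.sign x := by
  rcases hx.lt_or_gt with h | h
  · simp [rhobar, h, Real.sign_of_neg]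
  · simp [rhobar, h, h.not_gt, Real.sign_of_pos]

theorem continuousOn_rhobar_time {α : ℝ} (hα : 0 < α) {x : ℝ} (hx : x ≠ 0) :
    ContinuousOn (fun t => rhobar α (x, t)) (Set.Ici 0) := by
  have h : ContinuousOn (fun t : ℝ => x / max |x| (2 * α * t)) (Set.Ici 0) :=
    ContinuousOn.div (by fun_prop) (by fun_prop)
      fun t _ => (lt_max_of_lt_left (abs_pos.2 hx)).ne'
  exact h.congr fun t ht => rhobar_eq_div_max hα x ht

theorem continuous_rhobar_space {α : ℝ} (hα : 0 < α) {t : ℝ} (ht : 0 < t) :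
    Continuous (fun x => rhobar α (x, t)) := by
  have h : Continuous (fun x : ℝ => x / max |x| (2 * α * t)) :=
    Continuous.div (by fun_prop) (by fun_prop)
      fun x => (lt_max_of_lt_right (by positivity)).ne'
  exact h.congr fun x => (rhobar_eq_div_max hα x ht.le).symm

theorem rhobar_of_abs_lt {α x t : ℝ} (h : |x| < 2 * α * t) :
    rhobar α (x, t) = x / (2 * α * t) := by
  obtain ⟨h1, h2⟩ := abs_lt.1 h
  simp [rhobar, h1.not_gt, h2.not_gt]

theorem rhobar_of_lt_abs {α x t : ℝ} (hα : 0 < α) (ht : 0 ≤ t) (h : 2 * α * t < |x|) :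
    rhobar α (x, t) = x / |x| := by
  rw [rhobar_eq_div_max hα x ht, max_eq_left h.le]

theorem hasDerivAt_rhobar_time {α : ℝ} (hα : 0 < α) {x t : ℝ} (ht : 0 < t)
    (hne : |x| ≠ 2 * α * t) :
    HasDerivAt (fun s => rhobar α (x, s)) (-fanSlope α (x, t)) t := by
  rcases hne.lt_or_gt with h | h
  · have hd : HasDerivAt (fun s : ℝ => x / (2 * α * s)) (-fanSlope α (x, t)) t := by
      have := (hasDerivAt_const t x).div ((hasDerivAt_id t).const_mul (2 * α))
        (by simp only [id]; positivity)
      refine this.congr_deriv ?_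
      simp only [fanSlope, h, if_true, id]
      field_simp
      ring
    refine hd.congr_of_eventuallyEq ?_
    have : ∀ᶠ s in nhds t, |x| < 2 * α * s :=
      (by fun_prop : Continuous fun s : ℝ => 2 * α * s).continuousAt.eventually_const_lt h
    filter_upwards [this] with s hs using rhobar_of_abs_lt hs
  · have hd : HasDerivAt (fun _ : ℝ => x / |x|) (-fanSlope α (x, t)) t :=
      (hasDerivAt_const t _).congr_deriv (by simp [fanSlope, h.not_gt])
    refine hd.congr_of_eventuallyEq ?_
    have : ∀ᶠ s in nhds t, 2 * α * s < |x| :=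
      (by fun_prop : Continuous fun s : ℝ => 2 * α * s).continuousAt.eventually_lt_const h
    filter_upwards [this, lt_mem_nhds ht] with s hs hs0 using rhobar_of_lt_abs hα hs0.le hs

theorem mbar2_of_lt_abs {α x t : ℝ} (hα : 0 < α) (ht : 0 ≤ t) (h : 2 * α * t < |x|) :
    mbar2 α (x, t) = 0 := by
  have hx : |x| ≠ 0 := ((by positivity : 0 ≤ 2 * α * t).trans_lt h).ne'
  rw [mbar2, rhobar_of_lt_abs hα ht h, div_pow, sq_abs, div_self (by simpa using hx)]
  simp

theorem hasDerivAt_mbar2_space {α : ℝ} (hα : 0 < α) {x t : ℝ} (ht : 0 < t)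
    (hne : |x| ≠ 2 * α * t) :
    HasDerivAt (fun y => mbar2 α (y, t)) (fanSlope α (x, t)) x := by
  rcases hne.lt_or_gt with h | h
  · have hd : HasDerivAt (fun y : ℝ => -α * (1 - (y / (2 * α * t)) ^ 2)) (fanSlope α (x, t)) x := by
      have := ((((hasDerivAt_id x).div_const (2 * α * t)).pow 2).const_sub 1).const_mul (-α)
      refine this.congr_deriv ?_
      simp only [fanSlope, h, if_true, id]
      norm_num
      field_simp
    refine hd.congr_of_eventuallyEq ?_
    filter_upwards [continuous_abs.continuousAt.eventually_lt_const h] with y hy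
    rw [mbar2, rhobar_of_abs_lt hy]
  · have hd : HasDerivAt (fun _ : ℝ => (0 : ℝ)) (fanSlope α (x, t)) x :=
      (hasDerivAt_const x _).congr_deriv (by simp [fanSlope, h.not_gt])
    refine hd.congr_of_eventuallyEq ?_
    filter_upwards [continuous_abs.continuousAt.eventually_const_lt h] with y hy
      using mbar2_of_lt_abs hα ht.le hy

theorem abs_fanSlope_le {α : ℝ} (hα : 0 < α) (x : ℝ) {t : ℝ} (ht : 0 < t) :
    |fanSlope α (x, t)| ≤
      (Set.Icc (-(2 * α * t)) (2 * α * t)).indicator (fun _ => 1 / t) x := by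
  unfold fanSlope
  dsimp only
  split_ifs with h
  · rw [Set.indicator_of_mem (Set.mem_Icc.2 (abs_le.1 h.le)), abs_div,
      abs_of_pos (by positivity : 0 < 2 * α * t ^ 2), div_le_div_iff₀ (by positivity) ht]
    nlinarith
  · rw [abs_zero]
    exact Set.indicator_nonneg (fun _ _ => by positivity) _

theorem integrable_fanSlope {α : ℝ} (hα : 0 < α) (T : ℝ) :
    Integrable (fanSlope α)
      ((volume.restrict (Set.Ioo (-1 : ℝ) 1)).prod (volume.restrict (Set.Ioo (0 : ℝ) T))) := by
  have hm := measurable_fanSlope α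
  have hI : ∀ t : ℝ, Integrable
      ((Set.Icc (-(2 * α * t)) (2 * α * t)).indicator (fun _ => 1 / t)) volume := fun t =>
    (integrable_indicator_iff measurableSet_Icc).2 (by simp)
  have hslice : ∀ t ∈ Set.Ioo 0 T, Integrable (fun x => fanSlope α (x, t)) volume := fun t ht =>
    (hI t).mono' (hm.comp (by fun_prop)).aestronglyMeasurable
      (Filter.Eventually.of_forall fun x => abs_fanSlope_le hα x ht.1)
  refine (integrable_prod_iff' hm.aestronglyMeasurable).2 ⟨?_, ?_⟩
  · filter_upwards [ae_restrict_mem measurableSet_Ioo] with t ht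
    exact (hslice t ht).restrict
  · refine Integrable.of_bound (C := 4 * α)
      hm.aestronglyMeasurable.norm.prod_swap.integral_prod_right' ?_
    filter_upwards [ae_restrict_mem measurableSet_Ioo] with t ht
    have ht0 : 0 < t := ht.1
    rw [Real.norm_of_nonneg (integral_nonneg fun _ => norm_nonneg _)]
    calc ∫ x in Set.Ioo (-1 : ℝ) 1, ‖fanSlope α (x, t)‖
        ≤ ∫ x, ‖fanSlope α (x, t)‖ :=
          setIntegral_le_integral (hslice t ht).norm
            (Filter.Eventually.of_forall fun _ => norm_nonneg _)
      _ ≤ ∫ x, (Set.Icc (-(2 * α * t)) (2 * α * t)).indicator (fun _ => 1 / t) x :=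
          integral_mono (hslice t ht).norm (hI t) fun x => abs_fanSlope_le hα x ht0
      _ = 4 * α := by
          rw [integral_indicator measurableSet_Icc, setIntegral_const, measureReal_def,
            Real.volume_Icc, ENNReal.toReal_ofReal (by nlinarith [mul_pos hα ht0]), smul_eq_mul]
          field_simp
          ring

theorem Continuous.integrable_mul_of_integrable {ψ h : ℝ × ℝ → ℝ} (hψ : Continuous ψ) (a b T : ℝ)
    (hh : Integrable h
      ((volume.restrict (Set.Ioo a b)).prod (volume.restrict (Set.Ioo (0 : ℝ) T)))) :
    Integrable (fun p => ψ p * h p)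
      ((volume.restrict (Set.Ioo a b)).prod (volume.restrict (Set.Ioo (0 : ℝ) T))) := by
  obtain ⟨C, hC⟩ := ((isCompact_Icc (a := a) (b := b)).prod
    (isCompact_Icc (a := 0) (b := T))).exists_bound_of_continuousOn hψ.continuousOn
  refine hh.bdd_mul (c := C) hψ.aestronglyMeasurable ?_
  rw [Measure.prod_restrict]
  filter_upwards [ae_restrict_mem (measurableSet_Ioo.prod measurableSet_Ioo)] with p hp
  exact hC p ⟨Set.Ioo_subset_Icc_self hp.1, Set.Ioo_subset_Icc_self hp.2⟩

theorem integrable_of_bound_of_nonneg_time {h : ℝ × ℝ → ℝ} (hm : Measurable h) (C a b T : ℝ)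
    (hC : ∀ x t, 0 ≤ t → |h (x, t)| ≤ C) :
    Integrable h ((volume.restrict (Set.Ioo a b)).prod (volume.restrict (Set.Ioo (0 : ℝ) T))) := by
  refine Integrable.of_bound (C := C) hm.aestronglyMeasurable ?_
  rw [Measure.prod_restrict]
  filter_upwards [ae_restrict_mem (measurableSet_Ioo.prod measurableSet_Ioo)] with p hp
  exact hC p.1 p.2 hp.2.1.le

/-- Integration by parts in time. -/
theorem integral_time_slice {α T : ℝ} (hα : 0 < α) (hT : 0 < T) {φ : ℝ × ℝ → ℝ}
    (hφ : ContDiff ℝ (⊤ : ℕ∞) φ) {x : ℝ} (hx : x ≠ 0) (hφT : φ (x, T) = 0)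
    (hint : IntegrableOn
      (fun t => dt φ (x, t) * rhobar α (x, t) - φ (x, t) * fanSlope α (x, t)) (Set.Ioo 0 T)) :
    ∫ t in Set.Ioo 0 T, (dt φ (x, t) * rhobar α (x, t) - φ (x, t) * fanSlope α (x, t)) =
      -(φ (x, 0) * Real.sign x) := by
  have key := integral_eq_of_hasDerivAt_off_countable
    (fun t => φ (x, t) * rhobar α (x, t))
    (fun t => dt φ (x, t) * rhobar α (x, t) - φ (x, t) * fanSlope α (x, t))
    (a := 0) (b := T) (s := {|x| / (2 * α)}) (Set.countable_singleton _) ?_ ?_ ?_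
  · rw [← integral_Ioc_eq_integral_Ioo, ← intervalIntegral.integral_of_le hT.le, key, hφT,
      rhobar_zero hx]
    ring
  · rw [Set.uIcc_of_le hT.le]
    exact (hφ.continuous.comp (by fun_prop)).continuousOn.mul
      ((continuousOn_rhobar_time hα hx).mono Set.Icc_subset_Ici_self)
  · rintro t ⟨ht, hts⟩
    rw [min_eq_left hT.le, max_eq_right hT.le] at ht
    have hne : |x| ≠ 2 * α * t := fun h => hts (by
      rw [Set.mem_singleton_iff, h]; field_simp)
    exact ((dt_hasDerivAt hφ x t).mul (hasDerivAt_rhobar_time hα ht.1 hne)).congr_deriv (by ring)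
  · rwa [intervalIntegrable_iff_integrableOn_Ioo_of_le hT.le]

/-- Integration by parts in space; the flux vanishes at `x = ±1` before the fan reaches it. -/
theorem integral_space_slice {α t : ℝ} (hα : 0 < α) (ht : 0 < t) (htT : 2 * α * t < 1)
    {φ : ℝ × ℝ → ℝ} (hφ : ContDiff ℝ (⊤ : ℕ∞) φ)
    (hint : IntegrableOn
      (fun x => dx φ (x, t) * mbar2 α (x, t) + φ (x, t) * fanSlope α (x, t)) (Set.Ioo (-1) 1)) :
    ∫ x in Set.Ioo (-1 : ℝ) 1, (dx φ (x, t) * mbar2 α (x, t) + φ (x, t) * fanSlope α (x, t)) =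
      0 := by
  have h11 : (-1 : ℝ) ≤ 1 := by norm_num
  have key := integral_eq_of_hasDerivAt_off_countable
    (fun x => φ (x, t) * mbar2 α (x, t))
    (fun x => dx φ (x, t) * mbar2 α (x, t) + φ (x, t) * fanSlope α (x, t))
    (a := -1) (b := 1) (s := {2 * α * t, -(2 * α * t)}) (Set.toFinite _).countable ?_ ?_ ?_
  · rw [← integral_Ioc_eq_integral_Ioo, ← intervalIntegral.integral_of_le h11, key,
      mbar2_of_lt_abs hα ht.le (by simpa using htT),
      mbar2_of_lt_abs hα ht.le (by simpa using htT)]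
    ring
  · have := continuous_rhobar_space hα ht
    have := hφ.continuous
    unfold mbar2
    fun_prop
  · rintro x ⟨-, hxs⟩
    have hne : |x| ≠ 2 * α * t := fun h => hxs (by
      simpa using eq_or_eq_neg_of_abs_eq h)
    exact (dx_hasDerivAt hφ x t).mul (hasDerivAt_mbar2_space hα ht hne)
  · rwa [intervalIntegrable_iff_integrableOn_Ioo_of_le h11]

theorem stmt12 (α : ℝ) (hα : α ∈ Set.Ioc (0 : ℝ) 1) (T : ℝ) (hT : T = 1 / (2 * α)) :
    -- pointwise bounds on (−1,1) × (0,T)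
    (∀ p : ℝ × ℝ, p.1 ∈ Set.Ioo (-1 : ℝ) 1 → p.2 ∈ Set.Ioo 0 T →
      |rhobar α p| ≤ 1 ∧ -(1 - rhobar α p ^ 2) ≤ mbar2 α p ∧ mbar2 α p ≤ 0) ∧
    -- weak formulation of ∂_t ρ̄ + ∂_{x₂} m̄₂ = 0 with initial data sign(x₂) and
    -- zero flux at x₂ = ±1: test functions are smooth on the closed strip, not
    -- required to vanish at x₂ = ±1, and vanish for t near T.
    (∀ φ : ℝ × ℝ → ℝ, ContDiff ℝ (⊤ : ℕ∞) φ →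
      (∃ T' : ℝ, T' < T ∧ ∀ p : ℝ × ℝ, T' ≤ p.2 → φ p = 0) →
      (∫ p in Set.Ioo (-1 : ℝ) 1 ×ˢ Set.Ioo (0 : ℝ) T,
          (dt φ p * rhobar α p + dx φ p * mbar2 α p))
        + (∫ x in Set.Ioo (-1 : ℝ) 1, φ (x, 0) * Real.sign x) = 0) := by
  obtain ⟨hα0, hα1⟩ := hα
  have hTpos : 0 < T := by rw [hT]; positivity
  refine ⟨?_, ?_⟩
  · rintro ⟨x, t⟩ - ht
    have h := abs_rhobar_le_one hα0 x ht.1.le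
    have h2 := (sq_le_one_iff_abs_le_one _).2 h
    refine ⟨h, ?_, ?_⟩ <;> unfold mbar2 <;> nlinarith
  · rintro φ hφ ⟨T', hT', hvan⟩
    have hA := (continuous_dt hφ).integrable_mul_of_integrable (-1) 1 T
      (integrable_of_bound_of_nonneg_time (measurable_rhobar α) 1 (-1) 1 T
        fun x t ht => abs_rhobar_le_one hα0 x ht)
    have hB := (continuous_dx hφ).integrable_mul_of_integrable (-1) 1 T
      (integrable_of_bound_of_nonneg_time (measurable_mbar2 α) α (-1) 1 T
        fun x t ht => abs_mbar2_le hα0 x ht)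
    have hG := hφ.continuous.integrable_mul_of_integrable (-1) 1 T (integrable_fanSlope hα0 T)
    have hAG := hA.sub hG
    have hBG := hB.add hG
    have htime : ∫ p, (dt φ p * rhobar α p - φ p * fanSlope α p)
        ∂((volume.restrict (Set.Ioo (-1 : ℝ) 1)).prod (volume.restrict (Set.Ioo (0 : ℝ) T))) =
        -∫ x in Set.Ioo (-1 : ℝ) 1, φ (x, 0) * Real.sign x := by
      rw [← integral_neg]
      refine (integral_prod _ hAG).trans (integral_congr_ae ?_)
      filter_upwards [hAG.prod_right_ae, ae_restrict_of_ae (Measure.ae_ne volume 0)] with x hi hx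
      exact integral_time_slice hα0 hTpos hφ hx (hvan (x, T) hT'.le) hi
    have hspace : ∫ p, (dx φ p * mbar2 α p + φ p * fanSlope α p)
        ∂((volume.restrict (Set.Ioo (-1 : ℝ) 1)).prod (volume.restrict (Set.Ioo (0 : ℝ) T))) =
        0 := by
      refine (integral_prod_symm _ hBG).trans (integral_eq_zero_of_ae ?_)
      filter_upwards [hBG.prod_left_ae, ae_restrict_mem measurableSet_Ioo] with t hi ht
      refine integral_space_slice hα0 ht.1 ?_ hφ hi
      have := ht.2
      rw [hT, lt_div_iff₀ (by positivity)] at this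
      linarith
    rw [Measure.volume_eq_prod, ← Measure.prod_restrict, ← eq_neg_iff_add_eq_zero, ← htime]
    refine Eq.trans ?_ ((integral_add hAG hBG).trans ((congrArg _ hspace).trans (add_zero _)))
    congr 1
    funext p
    simp only [Pi.add_apply, Pi.sub_apply]
    ring
end

section
/- Let T > 0 and let ρ̄, m̄₂ ∈ L^∞((−1,1) × (0,T)) satisfy: |ρ̄| ≤ 1 a.e.; m̄₂ ≥ −(1 − ρ̄²) a.e.; and for every φ ∈ C^∞([−1,1] × [0,T)) with compact support in time, ∫₀^T ∫_{−1}^{1} (∂_t φ · ρ̄ + ∂_{x₂} φ · m̄₂) dx₂ dt + ∫_{−1}^{1} φ(x₂,0) sign(x₂) dx₂ = 0. Then ρ̄(x₂,t) = 1 for a.e. (x₂,t) with x₂ > 2t, and ρ̄(x₂,t) = −1 for a.e. (x₂,t) with x₂ < −2t. -/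
open MeasureTheory

/-- The strip (−1,1) × (0,T), with coordinates (x₂, t). -/
def Strip (T : ℝ) : Set (ℝ × ℝ) := Set.Ioo (-1 : ℝ) 1 ×ˢ Set.Ioo (0 : ℝ) T

lemma exists_smooth_ramp : ∃ E D : ℝ → ℝ, ContDiff ℝ (⊤ : ℕ∞) E ∧ Continuous D ∧
    (∀ x, HasDerivAt E (D x) x) ∧ (∀ x ≤ 0, E x = 0) ∧ (∀ x, 0 < x → 0 < E x) ∧
    (∀ x, 0 ≤ D x) ∧ (∀ x, 0 < x → 0 < D x) := by
  have hd : ∀ x, HasDerivAt expNegInvGlue (x⁻¹ ^ 2 * expNegInvGlue x) x := fun x => by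
    simpa using expNegInvGlue.hasDerivAt_polynomial_eval_inv_mul 1 x
  refine ⟨expNegInvGlue, fun x => x⁻¹ ^ 2 * expNegInvGlue x, expNegInvGlue.contDiff, ?_, hd,
    fun x hx => expNegInvGlue.zero_of_nonpos hx, fun x hx => expNegInvGlue.pos_of_pos hx,
    fun x => mul_nonneg (sq_nonneg _) (expNegInvGlue.nonneg x), fun x hx => ?_⟩
  · have h := expNegInvGlue.continuous_polynomial_eval_inv_mul (Polynomial.X ^ 2)
    exact h.congr fun x => by rw [Polynomial.eval_pow, Polynomial.eval_X]
  · have := expNegInvGlue.pos_of_pos hx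
    positivity

lemma Continuous.integrableOn_strip {f : ℝ × ℝ → ℝ} (hf : Continuous f) (T : ℝ) :
    IntegrableOn f (Strip T) :=
  (hf.continuousOn.integrableOn_compact (isCompact_Icc.prod isCompact_Icc)).mono_set
    (Set.prod_mono Set.Ioo_subset_Icc_self Set.Ioo_subset_Icc_self)

lemma integral_strip_of_hasDerivAt {T : ℝ} (hT : 0 < T) {f f' : ℝ × ℝ → ℝ} (hf' : Continuous f')
    (hf : ∀ p : ℝ × ℝ, HasDerivAt (fun s => f (p.1, s)) (f' p) p.2) :
    ∫ p in Strip T, f' p = ∫ x in Set.Ioo (-1 : ℝ) 1, (f (x, T) - f (x, 0)) := by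
  have h := hf'.integrableOn_strip T
  rw [Strip, Measure.volume_eq_prod] at *
  rw [setIntegral_prod _ h]
  congr 1
  ext x
  rw [← integral_Ioc_eq_integral_Ioo, ← intervalIntegral.integral_of_le hT.le]
  have hc : Continuous fun t => f' (x, t) := by fun_prop
  exact intervalIntegral.integral_eq_sub_of_hasDerivAt (f := fun t => f (x, t))
    (fun t _ => hf (x, t)) (hc.intervalIntegrable _ _)

/-- Comparison with the rarefaction front, on the side of the interface selected by the
sign `s`, at times bounded away from the final time. -/
lemma ae_eq_sign_of_subsolution_before {T : ℝ} (hT : 0 < T) {ρ m2 : ℝ × ℝ → ℝ}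
    (hρmeas : Measurable ρ) (hm2meas : Measurable m2)
    (hρ1 : ∀ᵐ p ∂(volume.restrict (Strip T)), |ρ p| ≤ 1)
    (hm2bdd : ∃ C : ℝ, ∀ᵐ p ∂(volume.restrict (Strip T)), |m2 p| ≤ C)
    (hm2low : ∀ᵐ p ∂(volume.restrict (Strip T)), -(1 - ρ p ^ 2) ≤ m2 p)
    (hweak : ∀ φ : ℝ × ℝ → ℝ, ContDiff ℝ (⊤ : ℕ∞) φ →
      (∃ T' : ℝ, T' < T ∧ ∀ p : ℝ × ℝ, T' ≤ p.2 → φ p = 0) →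
      (∫ p in Strip T, (dt φ p * ρ p + dx φ p * m2 p))
        + (∫ x in Set.Ioo (-1 : ℝ) 1, φ (x, 0) * Real.sign x) = 0)
    {s : ℝ} (hs : s = 1 ∨ s = -1) {T' : ℝ} (hT' : T' < T) :
    ∀ᵐ p ∂(volume.restrict (Strip T)), p.2 < T' → 2 * p.2 < s * p.1 → ρ p = s := by
  obtain ⟨E, D, hE, hD, hED, hE0, hEpos, hD0, hDpos⟩ := exists_smooth_ramp
  obtain ⟨C, hC⟩ := hm2bdd
  have hEnn : ∀ x, 0 ≤ E x := fun x =>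
    (le_or_gt x 0).elim (fun h => (hE0 x h).ge) fun h => (hEpos x h).le
  have hEc := hE.continuous
  have hss : s * s = 1 := by rcases hs with rfl | rfl <;> norm_num
  let φ : ℝ × ℝ → ℝ := fun p => E (s * p.1 - 2 * p.2) * E (T' - p.2)
  let φt : ℝ × ℝ → ℝ := fun p =>
    -2 * D (s * p.1 - 2 * p.2) * E (T' - p.2) - E (s * p.1 - 2 * p.2) * D (T' - p.2)
  let φx : ℝ × ℝ → ℝ := fun p => s * D (s * p.1 - 2 * p.2) * E (T' - p.2)
  have hφ : ContDiff ℝ (⊤ : ℕ∞) φ :=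
    (hE.comp (by fun_prop)).mul (hE.comp (by fun_prop))
  have hφtc : Continuous φt := by fun_prop
  have hφxc : Continuous φx := by fun_prop
  have hφt : ∀ p : ℝ × ℝ, HasDerivAt (fun t => φ (p.1, t)) (φt p) p.2 := fun p => by
    have h1 : HasDerivAt (fun t : ℝ => s * p.1 - 2 * t) (-2) p.2 := by
      simpa using ((hasDerivAt_id p.2).const_mul 2).const_sub (s * p.1)
    have h2 : HasDerivAt (fun t : ℝ => T' - t) (-1) p.2 := by
      simpa using (hasDerivAt_id p.2).const_sub T'
    convert! ((hED _).comp p.2 h1).mul ((hED _).comp p.2 h2) using 1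
    simp only [φt, Function.comp_apply]
    ring
  have hφx : ∀ p : ℝ × ℝ, HasDerivAt (fun x => φ (x, p.2)) (φx p) p.1 := fun p => by
    have h1 : HasDerivAt (fun x : ℝ => s * x - 2 * p.2) s p.1 := by
      simpa using ((hasDerivAt_id p.1).const_mul s).sub_const (2 * p.2)
    convert! ((hED _).comp p.1 h1).mul_const (E (T' - p.2)) using 1
    simp only [φx]
    ring
  have hvanish : ∀ p : ℝ × ℝ, T' ≤ p.2 → φ p = 0 := fun p hp => by
    simp only [φ, hE0 _ (sub_nonpos.2 hp), mul_zero]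
  have hw := hweak φ hφ ⟨T', hT', hvanish⟩
  have hdt : dt φ = φt := funext fun p => (hφt p).deriv
  have hdx : dx φ = φx := funext fun p => (hφx p).deriv
  rw [hdt, hdx] at hw
  have hint : Integrable (fun p => φt p * ρ p + φx p * m2 p) (volume.restrict (Strip T)) :=
    ((hφtc.integrableOn_strip T).mul_bdd hρmeas.aestronglyMeasurable hρ1).add
      ((hφxc.integrableOn_strip T).mul_bdd hm2meas.aestronglyMeasurable hC)
  have hinit : ∫ x in Set.Ioo (-1 : ℝ) 1, φ (x, 0) * Real.sign x =
      s * ∫ x in Set.Ioo (-1 : ℝ) 1, φ (x, 0) := by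
    rw [← integral_const_mul]
    congr 1
    ext x
    rcases le_or_gt (s * x) 0 with h | h
    · have : φ (x, 0) = 0 := by
        simp only [φ, hE0 (s * x - 2 * 0) (by linarith), zero_mul]
      simp [this]
    · have : Real.sign x = s := by
        rcases hs with rfl | rfl
        · exact Real.sign_of_pos (by linarith)
        · exact Real.sign_of_neg (by linarith)
      rw [this, mul_comm]
  have htime : ∫ p in Strip T, φt p = -∫ x in Set.Ioo (-1 : ℝ) 1, φ (x, 0) := by
    rw [integral_strip_of_hasDerivAt hT hφtc hφt, ← integral_neg]
    congr 1
    ext x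
    rw [hvanish (x, T) hT'.le, zero_sub]
  let g : ℝ × ℝ → ℝ := fun p => E (s * p.1 - 2 * p.2) * D (T' - p.2) * (1 - s * ρ p)
  have hgi : Integrable g (volume.restrict (Strip T)) := by
    have hc : Continuous fun p : ℝ × ℝ => E (s * p.1 - 2 * p.2) * D (T' - p.2) := by fun_prop
    refine (hc.integrableOn_strip T).mul_bdd (c := 2) ?_ ?_
    · exact (measurable_const.sub (hρmeas.const_mul s)).aestronglyMeasurable
    · filter_upwards [hρ1] with p hp
      rw [abs_le] at hp
      rw [Real.norm_eq_abs, abs_le]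
      rcases hs with rfl | rfl <;> constructor <;> linarith [hp.1, hp.2]
  have hg0 : 0 ≤ᵐ[volume.restrict (Strip T)] g := by
    filter_upwards [hρ1] with p hp
    rw [abs_le] at hp
    refine mul_nonneg (mul_nonneg (hEnn _) (hD0 _)) ?_
    rcases hs with rfl | rfl <;> linarith [hp.1, hp.2]
  have hgle : g ≤ᵐ[volume.restrict (Strip T)]
      fun p => s * (φt p * ρ p + φx p * m2 p) - φt p := by
    filter_upwards [hm2low] with p hm
    have ha : 0 ≤ D (s * p.1 - 2 * p.2) * E (T' - p.2) := mul_nonneg (hD0 _) (hEnn _)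
    have hm' : 0 ≤ m2 p + 2 * (1 - s * ρ p) := by
      rcases hs with rfl | rfl <;> nlinarith [sq_nonneg (1 - ρ p), sq_nonneg (1 + ρ p)]
    have hkey : s * (φt p * ρ p + φx p * m2 p) - φt p - g p =
        D (s * p.1 - 2 * p.2) * E (T' - p.2) * (m2 p + 2 * (1 - s * ρ p)) := by
      simp only [φt, φx, g]
      linear_combination D (s * p.1 - 2 * p.2) * E (T' - p.2) * m2 p * hss
    have := mul_nonneg ha hm'
    linarith
  have hgint : ∫ p in Strip T, g p = 0 := by
    refine le_antisymm ?_ (integral_nonneg_of_ae hg0)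
    have hle := integral_mono_ae hgi ((hint.const_mul s).sub (hφtc.integrableOn_strip T)) hgle
    refine hle.trans_eq ?_
    rw [integral_sub' (hint.const_mul s) (hφtc.integrableOn_strip T), integral_const_mul, htime]
    rw [hinit] at hw
    linear_combination s * hw - (∫ x in Set.Ioo (-1 : ℝ) 1, φ (x, 0)) * hss
  filter_upwards [(integral_eq_zero_iff_of_nonneg_ae hg0 hgi).1 hgint] with p hp h1 h2
  have hpos := mul_pos (hEpos _ (sub_pos.2 h2)) (hDpos _ (sub_pos.2 h1))
  have h0 : 1 - s * ρ p = 0 := (mul_eq_zero.1 hp).resolve_left hpos.ne'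
  linear_combination (-s) * h0 - ρ p * hss

lemma ae_eq_sign_of_subsolution {T : ℝ} (hT : 0 < T) {ρ m2 : ℝ × ℝ → ℝ}
    (hρmeas : Measurable ρ) (hm2meas : Measurable m2)
    (hρ1 : ∀ᵐ p ∂(volume.restrict (Strip T)), |ρ p| ≤ 1)
    (hm2bdd : ∃ C : ℝ, ∀ᵐ p ∂(volume.restrict (Strip T)), |m2 p| ≤ C)
    (hm2low : ∀ᵐ p ∂(volume.restrict (Strip T)), -(1 - ρ p ^ 2) ≤ m2 p)
    (hweak : ∀ φ : ℝ × ℝ → ℝ, ContDiff ℝ (⊤ : ℕ∞) φ →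
      (∃ T' : ℝ, T' < T ∧ ∀ p : ℝ × ℝ, T' ≤ p.2 → φ p = 0) →
      (∫ p in Strip T, (dt φ p * ρ p + dx φ p * m2 p))
        + (∫ x in Set.Ioo (-1 : ℝ) 1, φ (x, 0) * Real.sign x) = 0)
    {s : ℝ} (hs : s = 1 ∨ s = -1) :
    ∀ᵐ p ∂(volume.restrict (Strip T)), 2 * p.2 < s * p.1 → ρ p = s := by
  have h : ∀ᵐ p ∂(volume.restrict (Strip T)), ∀ q : ℚ, (q : ℝ) < T →
      p.2 < (q : ℝ) → 2 * p.2 < s * p.1 → ρ p = s := by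
    rw [ae_all_iff]
    intro q
    by_cases hq : (q : ℝ) < T
    · filter_upwards [ae_eq_sign_of_subsolution_before hT hρmeas hm2meas hρ1 hm2bdd hm2low hweak
        hs hq] with p hp _
      exact hp
    · exact Filter.Eventually.of_forall fun p hq' => absurd hq' hq
  have hmem : ∀ᵐ p ∂(volume.restrict (Strip T)), p ∈ Strip T :=
    ae_restrict_mem (measurableSet_Ioo.prod measurableSet_Ioo)
  filter_upwards [h, hmem] with p hp hpT
  obtain ⟨q, hq1, hq2⟩ := exists_rat_btwn hpT.2.2
  exact hp q hq2 hq1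

theorem stmt13 (T : ℝ) (hT : 0 < T) (ρ m2 : ℝ × ℝ → ℝ)
    (hρmeas : Measurable ρ) (hm2meas : Measurable m2)
    -- ρ, m̄₂ ∈ L^∞((−1,1) × (0,T)) with |ρ| ≤ 1 a.e.
    (hρ1 : ∀ᵐ p ∂(volume.restrict (Strip T)), |ρ p| ≤ 1)
    (hm2bdd : ∃ C : ℝ, ∀ᵐ p ∂(volume.restrict (Strip T)), |m2 p| ≤ C)
    -- m̄₂ ≥ −(1 − ρ²) a.e.
    (hm2low : ∀ᵐ p ∂(volume.restrict (Strip T)), -(1 - ρ p ^ 2) ≤ m2 p)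
    -- weak formulation with initial data sign(x₂) and zero flux at x₂ = ±1:
    -- test functions are smooth on the closed strip, not required to vanish at
    -- x₂ = ±1, and vanish for t near T.
    (hweak : ∀ φ : ℝ × ℝ → ℝ, ContDiff ℝ (⊤ : ℕ∞) φ →
      (∃ T' : ℝ, T' < T ∧ ∀ p : ℝ × ℝ, T' ≤ p.2 → φ p = 0) →
      (∫ p in Strip T, (dt φ p * ρ p + dx φ p * m2 p))
        + (∫ x in Set.Ioo (-1 : ℝ) 1, φ (x, 0) * Real.sign x) = 0) :
    (∀ᵐ p ∂(volume.restrict (Strip T)), 2 * p.2 < p.1 → ρ p = 1) ∧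
    (∀ᵐ p ∂(volume.restrict (Strip T)), p.1 < -(2 * p.2) → ρ p = -1) := by
  constructor
  · filter_upwards [ae_eq_sign_of_subsolution hT hρmeas hm2meas hρ1 hm2bdd hm2low hweak
      (Or.inl rfl)] with p hp h
    exact hp (by linarith)
  · filter_upwards [ae_eq_sign_of_subsolution hT hρmeas hm2meas hρ1 hm2bdd hm2low hweak
      (Or.inr rfl)] with p hp h
    exact hp (by linarith)
end
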